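/- arXiv:1403.1399 — 2 statements merged into one kernel-verified Lean document; each statement's English description precedes it below -/
import Mathlib

section
/- Let H be a commutative Hopf algebra over a field k and let A be a commutative unital k-algebra with a right partial coaction ρ̄: A → A ⊗ H (satisfying (PRHCA1), (PRHCA2), (PRHCA3)). For algebra homomorphisms g, h: H → k set 1_g := (id_A ⊗ g)(ρ̄(1_A)), θ_g := (id_A ⊗ g)∘ρ̄, write g*h for the convolution product and g⁻¹ := g∘S. Then: (a) 1_ε = 1_A and θ_ε = id_A; (b) θ_{h⁻¹}(1_h 1_{g⁻¹} a) ∈ 1_{h⁻¹} 1_{(g*h)⁻¹} A for every a ∈ A; (c) θ_g(θ_h(x)) = θ_{g*h}(x) for every x ∈ θ_{h⁻¹}(1_h 1_{g⁻¹} A). -/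
open TensorProduct

/-- `sw2 k f g` is the Sweedler-style map `h ↦ ∑ f(h₍₁₎) * g(h₍₂₎)`. -/
noncomputable def sw2 (k : Type*) [Field k] {H A : Type*}
    [AddCommGroup H] [Module k H] [Coalgebra k H]
    [Ring A] [Algebra k A] (f g : H →ₗ[k] A) : H →ₗ[k] A :=
  TensorProduct.lift ((LinearMap.mul k A).compl₁₂ f g) ∘ₗ Coalgebra.comul
/-- A right partial coaction of a Hopf algebra `H` on a unital algebra `A`:
(PRHCA1) `ρ(ab) = ρ(a)ρ(b)`; (PRHCA2) `(id ⊗ ε)ρ(a) = a`;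
(PRHCA3) `(ρ ⊗ id)ρ(a) = [(id ⊗ Δ)ρ(a)](ρ(1) ⊗ 1)`. -/
structure IsRightPartialCoaction (k : Type*) [Field k] {H A : Type*}
    [Ring H] [HopfAlgebra k H] [Ring A] [Algebra k A] (ρ : A →ₗ[k] A ⊗[k] H) : Prop where
  prhca1 : ∀ a b : A, ρ (a * b) = ρ a * ρ b
  prhca2 : ∀ a : A,
    (TensorProduct.rid k A) ((TensorProduct.map LinearMap.id Coalgebra.counit) (ρ a)) = a
  prhca3 : ∀ a : A, (TensorProduct.map ρ LinearMap.id) (ρ a) =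
    ((TensorProduct.assoc k A H H).symm
      ((TensorProduct.map LinearMap.id (Coalgebra.comul (R := k))) (ρ a))) * (ρ 1 ⊗ₜ[k] (1 : H))

/-- `(id_A ⊗ g) : A ⊗ H → A` for a functional `g : H → k`. -/
noncomputable def evR (k : Type*) [Field k] {A H : Type*} [AddCommGroup A] [Module k A]
    [AddCommGroup H] [Module k H] (g : H →ₗ[k] k) : A ⊗[k] H →ₗ[k] A :=
  (TensorProduct.rid k A).toLinearMap ∘ₗ TensorProduct.map LinearMap.id g

/-- The idempotent `1_g = (id ⊗ g)(ρ(1_A))` associated to a partial coaction. -/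
noncomputable def pUnit (k : Type*) [Field k] {H A : Type*}
    [Ring H] [HopfAlgebra k H] [Ring A] [Algebra k A]
    (ρ : A →ₗ[k] A ⊗[k] H) (g : H →ₗ[k] k) : A :=
  evR k g (ρ 1)

/-- The map `θ_g = (id ⊗ g) ∘ ρ` associated to a partial coaction. -/
noncomputable def pTheta (k : Type*) [Field k] {H A : Type*}
    [Ring H] [HopfAlgebra k H] [Ring A] [Algebra k A]
    (ρ : A →ₗ[k] A ⊗[k] H) (g : H →ₗ[k] k) : A →ₗ[k] A :=
  evR k g ∘ₗ ρ

open WithConv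

section EvR

variable {k H A : Type*} [Field k]

@[simp]
lemma evR_tmul [AddCommGroup A] [Module k A] [AddCommGroup H] [Module k H]
    (g : H →ₗ[k] k) (a : A) (x : H) : evR k g (a ⊗ₜ[k] x) = g x • a := by
  simp [evR]

lemma evR_mul [Ring H] [Algebra k H] [Ring A] [Algebra k A] (g : H →ₐ[k] k) (t u : A ⊗[k] H) :
    evR k g.toLinearMap (t * u) = evR k g.toLinearMap t * evR k g.toLinearMap u := by
  induction t with
  | zero => simp
  | add t₁ t₂ h₁ h₂ => simp only [add_mul, map_add, h₁, h₂]
  | tmul a x =>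
    induction u with
    | zero => simp
    | add u₁ u₂ h₁ h₂ => simp only [mul_add, map_add, h₁, h₂]
    | tmul b y => simp [smul_smul, mul_comm]

lemma evR_map_id {B : Type*} [AddCommGroup A] [Module k A] [AddCommGroup B] [Module k B]
    [AddCommGroup H] [Module k H] (h : H →ₗ[k] k) (f : A →ₗ[k] B) (t : A ⊗[k] H) :
    evR k h (TensorProduct.map f LinearMap.id t) = f (evR k h t) := by
  induction t with
  | zero => simp
  | add t₁ t₂ h₁ h₂ => simp only [map_add, h₁, h₂]
  | tmul a x => simp

lemma evR_evR_assoc_symm_map_comul [AddCommGroup A] [Module k A] [AddCommGroup H] [Module k H]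
    [Coalgebra k H] (g h : H →ₗ[k] k) (t : A ⊗[k] H) :
    evR k g (evR k h ((TensorProduct.assoc k A H H).symm
      (TensorProduct.map LinearMap.id (Coalgebra.comul (R := k)) t))) = evR k (sw2 k g h) t := by
  induction t with
  | zero => simp
  | add t₁ t₂ h₁ h₂ => simp only [map_add, h₁, h₂]
  | tmul a x =>
    simp only [TensorProduct.map_tmul, LinearMap.id_apply, evR_tmul, sw2, LinearMap.comp_apply]
    induction Coalgebra.comul (R := k) x with
    | zero => simp
    | add t₁ t₂ h₁ h₂ => simp only [tmul_add, map_add, add_smul, h₁, h₂]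
    | tmul y z => simp [smul_smul, mul_comm]

end EvR

section PartialCoaction

variable {k H A : Type*} [Field k] [Ring H] [HopfAlgebra k H]

lemma sw2_toLinearMap (g h : WithConv (H →ₐ[k] k)) :
    sw2 k g.ofConv.toLinearMap h.ofConv.toLinearMap = (g * h).ofConv.toLinearMap := by
  ext x
  simp only [sw2, LinearMap.comp_apply, AlgHom.toLinearMap_apply, AlgHom.convMul_def,
    AlgHom.comp_apply, ofConv_toConv, Bialgebra.comulAlgHom_apply]
  induction Coalgebra.comul (R := k) x with
  | zero => simp
  | add t₁ t₂ h₁ h₂ => simp only [map_add, h₁, h₂]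
  | tmul y z => simp

namespace IsRightPartialCoaction

variable [Ring A] [Algebra k A] {ρ : A →ₗ[k] A ⊗[k] H}

lemma pTheta_counit (hρ : IsRightPartialCoaction k ρ) (a : A) :
    pTheta k ρ Coalgebra.counit a = a :=
  hρ.prhca2 a

lemma pTheta_mul (hρ : IsRightPartialCoaction k ρ) (g : H →ₐ[k] k) (a b : A) :
    pTheta k ρ g.toLinearMap (a * b) = pTheta k ρ g.toLinearMap a * pTheta k ρ g.toLinearMap b := by
  simp only [pTheta, LinearMap.comp_apply, hρ.prhca1, evR_mul]

lemma pTheta_pTheta (hρ : IsRightPartialCoaction k ρ) (g h : WithConv (H →ₐ[k] k)) (a : A) :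
    pTheta k ρ g.ofConv.toLinearMap (pTheta k ρ h.ofConv.toLinearMap a) =
      pTheta k ρ (g * h).ofConv.toLinearMap a * pUnit k ρ g.ofConv.toLinearMap := by
  simp only [pTheta, pUnit, LinearMap.comp_apply]
  rw [← evR_map_id, hρ.prhca3, evR_mul, evR_mul, evR_evR_assoc_symm_map_comul, sw2_toLinearMap]
  simp

lemma pTheta_pUnit (hρ : IsRightPartialCoaction k ρ) (g h : WithConv (H →ₐ[k] k)) :
    pTheta k ρ g.ofConv.toLinearMap (pUnit k ρ h.ofConv.toLinearMap) =
      pUnit k ρ (g * h).ofConv.toLinearMap * pUnit k ρ g.ofConv.toLinearMap :=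
  hρ.pTheta_pTheta g h 1

lemma pUnit_mul_pTheta (hρ : IsRightPartialCoaction k ρ) (g : H →ₐ[k] k) (a : A) :
    pUnit k ρ g.toLinearMap * pTheta k ρ g.toLinearMap a = pTheta k ρ g.toLinearMap a :=
  (hρ.pTheta_mul g 1 a).symm.trans (by rw [one_mul])

lemma pUnit_mul_self (hρ : IsRightPartialCoaction k ρ) (g : H →ₐ[k] k) :
    pUnit k ρ g.toLinearMap * pUnit k ρ g.toLinearMap = pUnit k ρ g.toLinearMap :=
  hρ.pUnit_mul_pTheta g 1

end IsRightPartialCoaction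

end PartialCoaction

/-- For a right partial coaction of a commutative Hopf algebra `H` on a commutative algebra `A`
and algebra homomorphisms `g h : H → k`, with `1_g := (id ⊗ g)(ρ(1))`, `θ_g := (id ⊗ g)∘ρ`,
convolution `g*h = ∑ g(x₍₁₎)h(x₍₂₎)` (given by `sw2 k g h`) and `g⁻¹ := g∘S`:
(a) `1_ε = 1` and `θ_ε = id`; (b) `θ_{h⁻¹}(1_h 1_{g⁻¹} a) ∈ 1_{h⁻¹} 1_{(g*h)⁻¹} A`;
(c) `θ_g ∘ θ_h = θ_{g*h}` on `θ_{h⁻¹}(1_h 1_{g⁻¹} A)`. -/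
theorem pTheta_comp_of_partialCoaction
    {k H A : Type*} [Field k] [CommRing H] [HopfAlgebra k H] [CommRing A] [Algebra k A]
    (ρ : A →ₗ[k] A ⊗[k] H) (hρ : IsRightPartialCoaction k ρ)
    (g : H →ₗ[k] k) (hg1 : g 1 = 1) (hgmul : ∀ x y : H, g (x * y) = g x * g y)
    (h : H →ₗ[k] k) (hh1 : h 1 = 1) (hhmul : ∀ x y : H, h (x * y) = h x * h y) :
    -- (a) `1_ε = 1_A` and `θ_ε = id_A`:
    (pUnit k ρ (Coalgebra.counit) = 1 ∧ ∀ a : A, pTheta k ρ (Coalgebra.counit) a = a) ∧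
    -- (b) `θ_{h⁻¹}(1_h 1_{g⁻¹} a) ∈ 1_{h⁻¹} 1_{(g*h)⁻¹} A`:
    (∀ a : A, ∃ b : A,
      pTheta k ρ (h ∘ₗ HopfAlgebra.antipode (R := k))
          (pUnit k ρ h * pUnit k ρ (g ∘ₗ HopfAlgebra.antipode (R := k)) * a) =
        pUnit k ρ (h ∘ₗ HopfAlgebra.antipode (R := k)) *
          pUnit k ρ (sw2 k g h ∘ₗ HopfAlgebra.antipode (R := k)) * b) ∧
    -- (c) `θ_g(θ_h(x)) = θ_{g*h}(x)` for every `x ∈ θ_{h⁻¹}(1_h 1_{g⁻¹} A)`: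
    (∀ a : A,
      pTheta k ρ g (pTheta k ρ h
        (pTheta k ρ (h ∘ₗ HopfAlgebra.antipode (R := k))
          (pUnit k ρ h * pUnit k ρ (g ∘ₗ HopfAlgebra.antipode (R := k)) * a))) =
      pTheta k ρ (sw2 k g h)
        (pTheta k ρ (h ∘ₗ HopfAlgebra.antipode (R := k))
          (pUnit k ρ h * pUnit k ρ (g ∘ₗ HopfAlgebra.antipode (R := k)) * a))) := by
  obtain ⟨g, rfl⟩ : ∃ G : WithConv (H →ₐ[k] k), G.ofConv.toLinearMap = g :=
    ⟨toConv (.ofLinearMap g hg1 hgmul), rfl⟩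
  obtain ⟨h, rfl⟩ : ∃ G : WithConv (H →ₐ[k] k), G.ofConv.toLinearMap = h :=
    ⟨toConv (.ofLinearMap h hh1 hhmul), rfl⟩
  have inv_eq (f : WithConv (H →ₐ[k] k)) :
      f.ofConv.toLinearMap ∘ₗ HopfAlgebra.antipode (R := k) = f⁻¹.ofConv.toLinearMap := rfl
  simp only [sw2_toLinearMap, inv_eq]
  refine ⟨⟨hρ.pTheta_counit 1, hρ.pTheta_counit⟩, fun a ↦ ?_, fun a ↦ ?_⟩
  · refine ⟨pTheta k ρ h⁻¹.ofConv.toLinearMap (pUnit k ρ h.ofConv.toLinearMap * a), ?_⟩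
    rw [mul_right_comm, hρ.pTheta_mul, hρ.pTheta_pUnit, mul_inv_rev]
    ring
  · rw [hρ.pTheta_pTheta]
    generalize pUnit k ρ h.ofConv.toLinearMap * pUnit k ρ g⁻¹.ofConv.toLinearMap * a = b
    rw [← hρ.pUnit_mul_pTheta h⁻¹.ofConv b, hρ.pTheta_mul, hρ.pTheta_pUnit, mul_inv_cancel_right]
    linear_combination (pUnit k ρ (g * h).ofConv.toLinearMap *
      pTheta k ρ (g * h).ofConv.toLinearMap (pTheta k ρ h⁻¹.ofConv.toLinearMap b)) *
      hρ.pUnit_mul_self g.ofConv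
end

section
/- Let H be a Hopf algebra over a field k, A a unital k-algebra, C a k-coalgebra, and (−,−): A ⊗ C → k a non-degenerate dual pairing. Suppose ·_l: H ⊗ C → C and ·_r: A ⊗ H → A are linear maps such that (a·_r h, c) = (a, h·_l c) for all a ∈ A, h ∈ H, c ∈ C. Then ·_l makes C a symmetric left partial H-module coalgebra if and only if ·_r makes A a symmetric right partial H-module algebra. -/
open TensorProduct

/-- `sw4 k f₁ f₂ h c = ∑ f₁(h₍₁₎ ⊗ c₍₁₎) ⊗ f₂(h₍₂₎ ⊗ c₍₂₎)` in Sweedler notation. -/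
noncomputable def sw4 (k : Type*) [Field k] {H C M N : Type*}
    [AddCommGroup H] [Module k H] [Coalgebra k H]
    [AddCommGroup C] [Module k C] [Coalgebra k C]
    [AddCommGroup M] [Module k M] [AddCommGroup N] [Module k N]
    (f₁ : H ⊗[k] C →ₗ[k] M) (f₂ : H ⊗[k] C →ₗ[k] N) (h : H) (c : C) : M ⊗[k] N :=
  (TensorProduct.map f₁ f₂)
    ((TensorProduct.tensorTensorTensorComm k H H C C)
      ((Coalgebra.comul (R := k) h) ⊗ₜ[k] (Coalgebra.comul (R := k) c)))
/-- A left partial `H`-module coalgebra: (PLHMC1) `Δ(h·c) = ∑ (h₍₁₎·c₍₁₎) ⊗ (h₍₂₎·c₍₂₎)`;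
(PLHMC2) `1·c = c`; (PLHMC3) `h·(g·c) = ∑ (hg₍₁₎·c₍₁₎) ε(g₍₂₎·c₍₂₎)`. -/
structure IsPartialModuleCoalgebra (k : Type*) [Field k] {H C : Type*} [Ring H] [Bialgebra k H]
    [AddCommGroup C] [Module k C] [Coalgebra k C] (act : H →ₗ[k] C →ₗ[k] C) : Prop where
  plhmc1 : ∀ (h : H) (c : C), Coalgebra.comul (R := k) (act h c) =
    sw4 k (TensorProduct.lift act) (TensorProduct.lift act) h c
  plhmc2 : ∀ c : C, act 1 c = c
  plhmc3 : ∀ (h g : H) (c : C), act h (act g c) =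
    (TensorProduct.rid k C) (sw4 k
      (TensorProduct.lift act ∘ₗ TensorProduct.map (LinearMap.mulLeft k h) LinearMap.id)
      (Coalgebra.counit ∘ₗ TensorProduct.lift act) g c)
/-- A symmetric left partial `H`-module coalgebra: a left partial `H`-module coalgebra
which moreover satisfies (PLHMC3') `h·(g·c) = ∑ ε(g₍₁₎·c₍₁₎) (hg₍₂₎·c₍₂₎)`. -/
structure IsSymmPartialModuleCoalgebra (k : Type*) [Field k] {H C : Type*}
    [Ring H] [Bialgebra k H] [AddCommGroup C] [Module k C] [Coalgebra k C]
    (act : H →ₗ[k] C →ₗ[k] C) extends IsPartialModuleCoalgebra k act : Prop where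
  plhmc3' : ∀ (h g : H) (c : C), act h (act g c) =
    (TensorProduct.lid k C) (sw4 k
      (Coalgebra.counit ∘ₗ TensorProduct.lift act)
      (TensorProduct.lift act ∘ₗ TensorProduct.map (LinearMap.mulLeft k h) LinearMap.id) g c)
/-- A symmetric right partial action of a Hopf algebra `H` on a unital algebra `A`:
(PRA1) `a·1 = a`; (PRA2) `(ab)·h = ∑ (a·h₍₁₎)(b·h₍₂₎)`;
(PRA3) `(a·h)·g = ∑ (a·hg₍₁₎)(1·g₍₂₎)`; (PRA3') `(a·h)·g = ∑ (1·g₍₁₎)(a·hg₍₂₎)`. -/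
structure IsSymmRightPartialAction (k : Type*) [Field k] {H A : Type*} [Ring H] [HopfAlgebra k H]
    [Ring A] [Algebra k A] (ract : A →ₗ[k] H →ₗ[k] A) : Prop where
  pra1 : ∀ a : A, ract a 1 = a
  pra2 : ∀ (a b : A) (h : H), ract (a * b) h = sw2 k (ract a) (ract b) h
  pra3 : ∀ (a : A) (h g : H),
    ract (ract a h) g = sw2 k (ract a ∘ₗ LinearMap.mulLeft k h) (ract 1) g
  pra3' : ∀ (a : A) (h g : H),
    ract (ract a h) g = sw2 k (ract 1) (ract a ∘ₗ LinearMap.mulLeft k h) g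
/-- A dual pairing `(-,-) : A ⊗ C → k` between a unital algebra `A` and a coalgebra `C`:
`(ab,c) = ∑ (a,c₍₁₎)(b,c₍₂₎)` and `(1,c) = ε(c)`. -/
structure IsAlgCoalgPairing (k : Type*) [Field k] {A C : Type*} [Ring A] [Algebra k A]
    [AddCommGroup C] [Module k C] [Coalgebra k C] (q : A →ₗ[k] C →ₗ[k] k) : Prop where
  pair_mul : ∀ (a b : A) (c : C), q (a * b) c =
    (TensorProduct.lid k k) (TensorProduct.map (q a) (q b) (Coalgebra.comul (R := k) c))
  pair_one : ∀ c : C, q 1 c = Coalgebra.counit c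

/-- The pairing of a Sweedler product with `c` is computed on the Sweedler components of `c`. -/
theorem IsAlgCoalgPairing.apply_sw2 {k H A C : Type*} [Field k] [AddCommGroup H] [Module k H]
    [Coalgebra k H] [Ring A] [Algebra k A] [AddCommGroup C] [Module k C] [Coalgebra k C]
    {q : A →ₗ[k] C →ₗ[k] k} (hq : IsAlgCoalgPairing k q) (f g : H →ₗ[k] A) (h : H) (c : C) :
    q (sw2 k f g h) c = TensorProduct.lid k k
      (sw4 k (TensorProduct.lift (q ∘ₗ f)) (TensorProduct.lift (q ∘ₗ g)) h c) := by
  simp only [sw2, sw4, LinearMap.comp_apply]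
  induction Coalgebra.comul (R := k) h with
  | zero => simp
  | add x y hx hy => simp only [map_add, LinearMap.add_apply, TensorProduct.add_tmul, hx, hy]
  | tmul x y =>
    simp only [TensorProduct.lift.tmul, LinearMap.compl₁₂_apply, LinearMap.mul_apply', hq.pair_mul]
    induction Coalgebra.comul (R := k) c with
    | zero => simp
    | add u v hu hv => simp only [map_add, TensorProduct.tmul_add, hu, hv]
    | tmul u v => simp

/-- Postcomposition of the two legs of `sw4`. -/
theorem map_sw4 {k H C M N M' N' : Type*} [Field k] [AddCommGroup H] [Module k H] [Coalgebra k H]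
    [AddCommGroup C] [Module k C] [Coalgebra k C] [AddCommGroup M] [Module k M]
    [AddCommGroup N] [Module k N] [AddCommGroup M'] [Module k M'] [AddCommGroup N'] [Module k N']
    (u : M →ₗ[k] M') (v : N →ₗ[k] N') (f : H ⊗[k] C →ₗ[k] M) (g : H ⊗[k] C →ₗ[k] N)
    (h : H) (c : C) :
    TensorProduct.map u v (sw4 k f g h c) = sw4 k (u ∘ₗ f) (v ∘ₗ g) h c := by
  simp only [sw4, TensorProduct.map_comp, LinearMap.comp_apply]

/-- A pairing that separates the points of `C` separates, leg by leg, the points of `C ⊗ C`. -/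
theorem tensor_ext_of_separating {k A C : Type*} [Field k] [AddCommGroup A] [Module k A]
    [AddCommGroup C] [Module k C] {q : A →ₗ[k] C →ₗ[k] k}
    (hq : ∀ c : C, (∀ a : A, q a c = 0) → c = 0) {x y : C ⊗[k] C}
    (hxy : ∀ a b : A, TensorProduct.lid k k (TensorProduct.map (q a) (q b) x) =
      TensorProduct.lid k k (TensorProduct.map (q a) (q b) y)) : x = y := by
  have hleg (a : A) : TensorProduct.lid k C ((q a).rTensor C (x - y)) = 0 := by
    refine hq _ fun b => ?_
    have hb (z : C ⊗[k] C) : q b (TensorProduct.lid k C ((q a).rTensor C z)) =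
        TensorProduct.lid k k (TensorProduct.map (q a) (q b) z) := by
      induction z with
      | zero => simp
      | add u v hu hv => simp only [map_add, hu, hv]
      | tmul u v => simp
    rw [hb, map_sub, map_sub, hxy, sub_self]
  classical
  let B := Module.Basis.ofVectorSpace k C
  rw [← sub_eq_zero, ← LinearEquiv.map_eq_zero_iff (TensorProduct.equivFinsuppOfBasisRight B)]
  ext i
  refine hq _ fun a => ?_
  have hcoord (z : C ⊗[k] C) : q a (TensorProduct.equivFinsuppOfBasisRight B z i) =
      B.repr (TensorProduct.lid k C ((q a).rTensor C z)) i := by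
    induction z with
    | zero => simp
    | add u v hu hv => simp only [map_add, Finsupp.add_apply, hu, hv]
    | tmul u v => simp [mul_comm]
  rw [hcoord, hleg, map_zero, Finsupp.zero_apply]

/-- Let `(-,-) : A ⊗ C → k` be a non-degenerate dual pairing between a unital algebra `A` and a
coalgebra `C`, and let `·_l : H ⊗ C → C` and `·_r : A ⊗ H → A` be linear maps such that
`(a ·_r h, c) = (a, h ·_l c)`. Then `·_l` makes `C` a symmetric left partial `H`-module
coalgebra if and only if `·_r` makes `A` a symmetric right partial `H`-module algebra. -/
theorem partialModuleCoalgebra_iff_rightPartialModuleAlgebra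
    {k H A C : Type*} [Field k] [Ring H] [HopfAlgebra k H]
    [Ring A] [Algebra k A] [AddCommGroup C] [Module k C] [Coalgebra k C]
    (q : A →ₗ[k] C →ₗ[k] k) (hq : IsAlgCoalgPairing k q)
    -- non-degeneracy of the pairing:
    (hnd₁ : ∀ a : A, (∀ c : C, q a c = 0) → a = 0)
    (hnd₂ : ∀ c : C, (∀ a : A, q a c = 0) → c = 0)
    (lact : H →ₗ[k] C →ₗ[k] C) (ract : A →ₗ[k] H →ₗ[k] A)
    -- compatibility `(a ·_r h, c) = (a, h ·_l c)`:
    (hcompat : ∀ (a : A) (h : H) (c : C), q (ract a h) c = q a (lact h c)) :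
    IsSymmPartialModuleCoalgebra k lact ↔ IsSymmRightPartialAction k ract := by
  have extA {a b : A} (hab : ∀ c, q a c = q b c) : a = b :=
    sub_eq_zero.mp (hnd₁ _ fun c => by simp [hab c])
  have extC {c d : C} (hcd : ∀ a, q a c = q a d) : c = d :=
    sub_eq_zero.mp (hnd₂ _ fun a => by simp [hcd a])
  have hlift (a : A) : TensorProduct.lift (q ∘ₗ ract a) = q a ∘ₗ TensorProduct.lift lact := by
    ext h c
    simp [hcompat]
  have hlift_mul (a : A) (h : H) :
      TensorProduct.lift (q ∘ₗ ract a ∘ₗ LinearMap.mulLeft k h) =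
        q a ∘ₗ TensorProduct.lift lact ∘ₗ
          TensorProduct.map (LinearMap.mulLeft k h) LinearMap.id := by
    ext g c
    simp [hcompat]
  have hlift_one : TensorProduct.lift (q ∘ₗ ract 1) =
      Coalgebra.counit ∘ₗ TensorProduct.lift lact := by
    ext h c
    simp [hcompat, hq.pair_one]
  have hrid (a : A) (z : C ⊗[k] k) : q a (TensorProduct.rid k C z) =
      TensorProduct.lid k k (TensorProduct.map (q a) LinearMap.id z) := by
    induction z with
    | zero => simp
    | add u v hu hv => simp only [map_add, hu, hv]
    | tmul u v => simp [mul_comm]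
  have hlid (a : A) (z : k ⊗[k] C) : q a (TensorProduct.lid k C z) =
      TensorProduct.lid k k (TensorProduct.map LinearMap.id (q a) z) := by
    induction z with
    | zero => simp
    | add u v hu hv => simp only [map_add, hu, hv]
    | tmul u v => simp
  have pair_mul_act (a b : A) (h : H) (c : C) : q (sw2 k (ract a) (ract b) h) c =
      TensorProduct.lid k k (TensorProduct.map (q a) (q b)
        (sw4 k (TensorProduct.lift lact) (TensorProduct.lift lact) h c)) := by
    rw [hq.apply_sw2, map_sw4, hlift, hlift]
  have pair_act_one (a : A) (h g : H) (c : C) :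
      q (sw2 k (ract a ∘ₗ LinearMap.mulLeft k h) (ract 1) g) c =
        q a (TensorProduct.rid k C (sw4 k
          (TensorProduct.lift lact ∘ₗ TensorProduct.map (LinearMap.mulLeft k h) LinearMap.id)
          (Coalgebra.counit ∘ₗ TensorProduct.lift lact) g c)) := by
    rw [hq.apply_sw2, hrid, map_sw4, hlift_mul, hlift_one, LinearMap.id_comp]
  have pair_one_act (a : A) (h g : H) (c : C) :
      q (sw2 k (ract 1) (ract a ∘ₗ LinearMap.mulLeft k h) g) c =
        q a (TensorProduct.lid k C (sw4 k
          (Coalgebra.counit ∘ₗ TensorProduct.lift lact)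
          (TensorProduct.lift lact ∘ₗ TensorProduct.map (LinearMap.mulLeft k h) LinearMap.id)
          g c)) := by
    rw [hq.apply_sw2, hlid, map_sw4, hlift_mul, hlift_one, LinearMap.id_comp]
  constructor
  · intro hC
    refine ⟨fun a => extA fun c => ?_, fun a b h => extA fun c => ?_,
      fun a h g => extA fun c => ?_, fun a h g => extA fun c => ?_⟩
    · rw [hcompat, hC.plhmc2]
    · rw [hcompat, hq.pair_mul, hC.plhmc1, pair_mul_act]
    · rw [hcompat, hcompat, hC.plhmc3, pair_act_one]
    · rw [hcompat, hcompat, hC.plhmc3', pair_one_act]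
  · intro hA
    refine ⟨⟨fun h c => tensor_ext_of_separating hnd₂ fun a b => ?_,
      fun c => extC fun a => ?_, fun h g c => extC fun a => ?_⟩, fun h g c => extC fun a => ?_⟩
    · rw [← hq.pair_mul, ← hcompat, hA.pra2, pair_mul_act]
    · rw [← hcompat, hA.pra1]
    · rw [← hcompat, ← hcompat, hA.pra3, pair_act_one]
    · rw [← hcompat, ← hcompat, hA.pra3', pair_one_act]
end
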